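/- arXiv:0910.4738 — 7 statements merged into one kernel-verified Lean document; each statement's English description precedes it below -/
import Mathlib

section
/- For every k ≥ 0 and every x ∈ X, V_k(x) equals the probability, under the Markov chain with transition kernel Q started at x, of the bounded-until event {Φ U^{≤k} Ψ}; that is, V_k(x) = P_x( { ω ∈ X^ℕ : ∃ i ≤ k, ω(i) ∈ Ψ and ω(j) ∈ Φ for all j < i } ). -/
open MeasureTheory ProbabilityTheory Filter

/-- The operator `L[W](x) = 1_Ψ(x) + 1_{Φ\Ψ}(x) ∫_X W(ξ) Q(x,dξ)`. -/
noncomputable def Lop {X : Type*} [MeasurableSpace X] (Q : Kernel X X) (Φ Ψ : Set X)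
    (W : X → ℝ) (x : X) : ℝ :=
  Ψ.indicator (fun _ => (1 : ℝ)) x + (Φ \ Ψ).indicator (fun _ => ∫ ξ, W ξ ∂(Q x)) x

/-- The set `M_b^{01}(Φ,Ψ)`. -/
def Mb01 {X : Type*} [MeasurableSpace X] (Φ Ψ : Set X) : Set (X → ℝ) :=
  {W | Measurable W ∧ (∃ C, ∀ x, |W x| ≤ C) ∧ (∀ x, 0 ≤ W x) ∧ (∀ x, W x ≤ 1) ∧
    (∀ x ∈ Ψ, W x = 1) ∧ ∀ x ∈ (Φ ∪ Ψ)ᶜ, W x = 0}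

/-- The iterates `V_0 = 1_Ψ`, `V_{k+1} = L[V_k]`. -/
noncomputable def Vseq {X : Type*} [MeasurableSpace X] (Q : Kernel X X) (Φ Ψ : Set X) :
    ℕ → X → ℝ
  | 0 => Ψ.indicator (fun _ => (1 : ℝ))
  | (k + 1) => Lop Q Φ Ψ (Vseq Q Φ Ψ k)

/-- The probability assigned by the Markov chain with kernel `Q` started at `δ_x` to the
cylinder set `{ω | ω 0 ∈ B 0, …, ω n ∈ B n}`, defined by the iterated integrals of
Ionescu-Tulcea: `cylProb Q 0 B x = 1_{B 0}(x)` and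
`cylProb Q (n+1) B x = 1_{B 0}(x) ∫_X cylProb Q n (B ∘ (·+1)) ξ Q(x,dξ)`. -/
noncomputable def cylProb {X : Type*} [MeasurableSpace X] (Q : Kernel X X) :
    ℕ → (ℕ → Set X) → X → ENNReal
  | 0 => fun B x => (B 0).indicator (fun _ => (1 : ENNReal)) x
  | (n + 1) => fun B x =>
      (B 0).indicator (fun _ => ∫⁻ ξ, cylProb Q n (fun i => B (i + 1)) ξ ∂(Q x)) x

/-- First-hit cylinder sets. -/
def untilB {X : Type*} (Φ Ψ : Set X) (i j : ℕ) : Set X := {x | (j < i ∧ x ∈ Φ \ Ψ) ∨ (¬ j < i ∧ x ∈ Ψ)}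

lemma untilB_lt {X : Type*} (Φ Ψ : Set X) {i j : ℕ} (h : j < i) : untilB Φ Ψ i j = Φ \ Ψ := by
  ext x; simp [untilB, h]

lemma untilB_ge {X : Type*} (Φ Ψ : Set X) {i j : ℕ} (h : ¬ j < i) : untilB Φ Ψ i j = Ψ := by
  ext x; simp only [untilB, h, Set.mem_setOf_eq]; simp

lemma untilB_succ {X : Type*} (Φ Ψ : Set X) (i : ℕ) :
    (fun j => untilB Φ Ψ (i + 1) (j + 1)) = untilB Φ Ψ i := by
  funext j; simp [untilB]

/-- The probability of first hitting at time `i`. -/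
noncomputable def untilU {X : Type*} [MeasurableSpace X] (Q : Kernel X X) (Φ Ψ : Set X)
    (i : ℕ) (x : X) : ENNReal := cylProb Q i (untilB Φ Ψ i) x

lemma untilU_zero {X : Type*} [MeasurableSpace X] (Q : Kernel X X) (Φ Ψ : Set X) (x : X) :
    untilU Q Φ Ψ 0 x = Ψ.indicator (fun _ => 1) x := by
  simp only [untilU, cylProb]
  rw [untilB_ge _ _ (by omega)]

lemma untilU_succ {X : Type*} [MeasurableSpace X] (Q : Kernel X X) (Φ Ψ : Set X) (i : ℕ) (x : X) :
    untilU Q Φ Ψ (i + 1) x = (Φ \ Ψ).indicator (fun y => ∫⁻ ξ, untilU Q Φ Ψ i ξ ∂(Q y)) x := by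
  simp only [untilU, cylProb]
  rw [untilB_lt _ _ (by omega), untilB_succ]
  simp only [Set.indicator]

lemma untilU_meas {X : Type*} [MeasurableSpace X] (Q : Kernel X X) (Φ Ψ : Set X)
    (hΦ : MeasurableSet Φ) (hΨ : MeasurableSet Ψ) (i : ℕ) : Measurable (untilU Q Φ Ψ i) := by
  induction i with
  | zero =>
    rw [show untilU Q Φ Ψ 0 = _ from funext (untilU_zero Q Φ Ψ)]
    exact measurable_const.indicator hΨ
  | succ i ih =>
    rw [show untilU Q Φ Ψ (i + 1) = _ from funext (untilU_succ Q Φ Ψ i)]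
    exact (ih.lintegral_kernel).indicator (hΦ.diff hΨ)

lemma untilB_meas {X : Type*} [MeasurableSpace X] (Φ Ψ : Set X)
    (hΦ : MeasurableSet Φ) (hΨ : MeasurableSet Ψ) (i j : ℕ) : MeasurableSet (untilB Φ Ψ i j) := by
  by_cases h : j < i
  · rw [untilB_lt _ _ h]; exact hΦ.diff hΨ
  · rw [untilB_ge _ _ h]; exact hΨ

lemma until_cyl_iff {X : Type*} (Φ Ψ : Set X) (i : ℕ) (ω : ℕ → X) :
    (∀ j ≤ i, ω j ∈ untilB Φ Ψ i j) ↔ ω i ∈ Ψ ∧ ∀ j < i, ω j ∈ Φ ∧ ω j ∉ Ψ := by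
  constructor
  · intro h
    refine ⟨by simpa [untilB_ge Φ Ψ (lt_irrefl i)] using h i le_rfl, fun j hj => ?_⟩
    simpa [untilB_lt Φ Ψ hj] using h j hj.le
  · rintro ⟨h1, h2⟩ j hj
    rcases hj.lt_or_eq with h | rfl
    · rw [untilB_lt _ _ h]; exact h2 j h
    · rw [untilB_ge _ _ (lt_irrefl _)]; exact h1

lemma until_set_eq {X : Type*} (Φ Ψ : Set X) (k : ℕ) :
    {ω : ℕ → X | ∃ i ≤ k, ω i ∈ Ψ ∧ ∀ j < i, ω j ∈ Φ} =
      ⋃ i ∈ Finset.range (k + 1), {ω : ℕ → X | ∀ j ≤ i, ω j ∈ untilB Φ Ψ i j} := by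
  classical
  ext ω
  simp only [until_cyl_iff, Set.mem_setOf_eq, Set.mem_iUnion, Finset.mem_range, exists_prop]
  constructor
  · rintro ⟨i, hi, h1, h2⟩
    have hex : ∃ i, ω i ∈ Ψ := ⟨i, h1⟩
    have hle := Nat.find_min' hex h1
    exact ⟨Nat.find hex, by omega, Nat.find_spec hex,
      fun j hj => ⟨h2 j (by omega), Nat.find_min hex hj⟩⟩
  · rintro ⟨i, hi, h1, h2⟩
    exact ⟨i, by omega, h1, fun j hj => (h2 j hj).1⟩

/-- `V_k(x)` equals the probability, under the chain started at `x`, of the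
bounded-until event `{Φ U^{≤k} Ψ}`. -/
theorem Vseq_eq_prob_bounded_until {X : Type*} [MeasurableSpace X] [StandardBorelSpace X]
    [Nonempty X]
    (Q : Kernel X X) [IsMarkovKernel Q]
    (Φ Ψ : Set X) (hΦ : MeasurableSet Φ) (hΨ : MeasurableSet Ψ)
    (P : X → Measure (ℕ → X)) [∀ x, IsProbabilityMeasure (P x)]
    (hP : ∀ (x : X) (n : ℕ) (B : ℕ → Set X), (∀ i, MeasurableSet (B i)) →
      P x {ω : ℕ → X | ∀ i ≤ n, ω i ∈ B i} = cylProb Q n B x) :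
    ∀ (k : ℕ) (x : X),
      Vseq Q Φ Ψ k x =
        (P x {ω : ℕ → X | ∃ i ≤ k, ω i ∈ Ψ ∧ ∀ j < i, ω j ∈ Φ}).toReal := by
  have hprob : ∀ k x, P x {ω : ℕ → X | ∃ i ≤ k, ω i ∈ Ψ ∧ ∀ j < i, ω j ∈ Φ} =
      ∑ i ∈ Finset.range (k + 1), untilU Q Φ Ψ i x := by
    intro k x
    rw [until_set_eq, measure_biUnion_finset]
    · exact Finset.sum_congr rfl fun i _ => hP x i _ (untilB_meas Φ Ψ hΦ hΨ i)
    · intro a _ b _ hab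
      refine Set.disjoint_left.2 fun ω ha hb => ?_
      have ha := (until_cyl_iff Φ Ψ a ω).1 ha
      have hb := (until_cyl_iff Φ Ψ b ω).1 hb
      rcases lt_or_gt_of_ne hab with h | h
      · exact (hb.2 a h).2 ha.1
      · exact (ha.2 b h).2 hb.1
    · intro i _
      have : {ω : ℕ → X | ∀ j ≤ i, ω j ∈ untilB Φ Ψ i j} =
          ⋂ j, ⋂ (_ : j ≤ i), (fun ω : ℕ → X => ω j) ⁻¹' untilB Φ Ψ i j := by
        ext ω; simp
      rw [this]
      exact MeasurableSet.iInter fun j => MeasurableSet.iInter fun _ =>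
        measurable_pi_apply j (untilB_meas Φ Ψ hΦ hΨ i j)
  have hfin : ∀ k x, ∑ i ∈ Finset.range (k + 1), untilU Q Φ Ψ i x < ⊤ := by
    intro k x
    rw [← hprob]
    exact measure_lt_top _ _
  intro k
  induction k with
  | zero =>
    intro x
    rw [hprob]
    simp only [Vseq, zero_add, Finset.sum_range_one, untilU_zero]
    by_cases h : x ∈ Ψ <;> simp [h]
  | succ k ih =>
    intro x
    have hV : ∫ ξ, Vseq Q Φ Ψ k ξ ∂(Q x) =
        (∑ i ∈ Finset.range (k + 1), ∫⁻ ξ, untilU Q Φ Ψ i ξ ∂(Q x)).toReal := by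
      simp only [ih, hprob]
      rw [integral_toReal, lintegral_finsetSum]
      · exact fun i _ => untilU_meas Q Φ Ψ hΦ hΨ i
      · exact (Finset.measurable_fun_sum _ fun i _ => untilU_meas Q Φ Ψ hΦ hΨ i).aemeasurable
      · exact Filter.Eventually.of_forall (hfin k)
    rw [hprob, Finset.sum_range_succ']
    simp only [Vseq, Lop, hV, untilU_zero, untilU_succ]
    by_cases h : x ∈ Ψ
    · simp [h]
    · by_cases h' : x ∈ Φ <;> simp [h, h']
end

section
/- The pointwise limit V(x) := lim_{k→∞} V_k(x) exists for every x ∈ X, the function V belongs to M_b^{01}(Φ,Ψ), and V satisfies the integral equation V(x) = 1_Ψ(x) + 1_{Φ\Ψ}(x) ∫_X V(ξ) Q(x, dξ) for all x ∈ X; i.e., V is a fixed point of L. -/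
open MeasureTheory ProbabilityTheory Filter

theorem Lop_cases {X : Type*} [MeasurableSpace X] (Q : Kernel X X) (Φ Ψ : Set X)
    (W : X → ℝ) (x : X) :
    (x ∈ Ψ ∧ Lop Q Φ Ψ W x = 1) ∨ (x ∈ Φ \ Ψ ∧ Lop Q Φ Ψ W x = ∫ ξ, W ξ ∂(Q x)) ∨
      (x ∈ (Φ ∪ Ψ)ᶜ ∧ Lop Q Φ Ψ W x = 0) := by
  by_cases h1 : x ∈ Ψ <;> by_cases h2 : x ∈ Φ <;> simp [Lop, h1, h2]

theorem Vseq_props {X : Type*} [MeasurableSpace X] (Q : Kernel X X) [IsMarkovKernel Q]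
    (Φ Ψ : Set X) (hΦ : MeasurableSet Φ) (hΨ : MeasurableSet Ψ) (k : ℕ) :
    Measurable (Vseq Q Φ Ψ k) ∧ (∀ x, 0 ≤ Vseq Q Φ Ψ k x) ∧ (∀ x, Vseq Q Φ Ψ k x ≤ 1) := by
  induction k with
  | zero =>
    refine ⟨measurable_const.indicator hΨ, fun x => ?_, fun x => ?_⟩ <;>
    by_cases h : x ∈ Ψ <;> simp [Vseq, h]
  | succ k ih =>
    obtain ⟨hm, h0, h1⟩ := ih
    refine ⟨?_, fun x => ?_, fun x => ?_⟩
    · have hI : Measurable (fun x => ∫ ξ, Vseq Q Φ Ψ k ξ ∂(Q x)) :=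
        (hm.stronglyMeasurable.integral_kernel).measurable
      exact (measurable_const.indicator hΨ).add (hI.indicator (hΦ.diff hΨ))
    · rcases Lop_cases Q Φ Ψ (Vseq Q Φ Ψ k) x with h | h | h <;> rw [Vseq, h.2]
      · exact zero_le_one
      · exact integral_nonneg h0
    · rcases Lop_cases Q Φ Ψ (Vseq Q Φ Ψ k) x with h | h | h <;> rw [Vseq, h.2]
      · calc ∫ ξ, Vseq Q Φ Ψ k ξ ∂(Q x) ≤ ∫ ξ, (1 : ℝ) ∂(Q x) :=
              integral_mono_of_nonneg (Eventually.of_forall h0) (integrable_const _)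
                (Eventually.of_forall h1)
          _ = 1 := by simp
      · exact zero_le_one

theorem Vseq_step {X : Type*} [MeasurableSpace X] (Q : Kernel X X) [IsMarkovKernel Q]
    (Φ Ψ : Set X) (hΦ : MeasurableSet Φ) (hΨ : MeasurableSet Ψ) (k : ℕ) :
    ∀ x, Vseq Q Φ Ψ k x ≤ Vseq Q Φ Ψ (k + 1) x := by
  induction k with
  | zero =>
    intro x
    have h0 := (Vseq_props Q Φ Ψ hΦ hΨ 0).2.1
    simp only [Vseq, Lop]
    exact le_add_of_nonneg_right
      (Set.indicator_nonneg (fun _ _ => integral_nonneg h0) x)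
  | succ k ih =>
    intro x
    obtain ⟨hm, h0, h1⟩ := Vseq_props Q Φ Ψ hΦ hΨ k
    obtain ⟨hm', h0', h1'⟩ := Vseq_props Q Φ Ψ hΦ hΨ (k + 1)
    have hi : ∫ ξ, Vseq Q Φ Ψ k ξ ∂(Q x) ≤ ∫ ξ, Vseq Q Φ Ψ (k + 1) ξ ∂(Q x) := by
      refine integral_mono_of_nonneg (Eventually.of_forall h0) ?_ (Eventually.of_forall ih)
      refine Integrable.of_bound hm'.aestronglyMeasurable 1 (Eventually.of_forall fun y => ?_)
      rw [Real.norm_eq_abs, abs_of_nonneg (h0' y)]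
      exact h1' y
    change Lop Q Φ Ψ (Vseq Q Φ Ψ k) x ≤ Lop Q Φ Ψ (Vseq Q Φ Ψ (k + 1)) x
    unfold Lop
    by_cases h : x ∈ Φ \ Ψ
    · simpa only [Set.indicator_of_mem h, add_le_add_iff_left] using hi
    · simp only [Set.indicator_of_notMem h, le_refl]

/-- The pointwise limit `V` of the `V_k` exists, belongs to `M_b^{01}(Φ,Ψ)`, and is a
fixed point of `L`, i.e. `V(x) = 1_Ψ(x) + 1_{Φ\Ψ}(x) ∫_X V(ξ) Q(x,dξ)` for all `x`. -/
theorem V_limit_fixed_point {X : Type*} [MeasurableSpace X] [StandardBorelSpace X] [Nonempty X]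
    (Q : Kernel X X) [IsMarkovKernel Q]
    (Φ Ψ : Set X) (hΦ : MeasurableSet Φ) (hΨ : MeasurableSet Ψ) :
    ∃ V : X → ℝ,
      (∀ x, Tendsto (fun k => Vseq Q Φ Ψ k x) atTop (nhds (V x))) ∧
      V ∈ Mb01 Φ Ψ ∧
      ∀ x, V x = Ψ.indicator (fun _ => (1 : ℝ)) x +
        (Φ \ Ψ).indicator (fun _ => ∫ ξ, V ξ ∂(Q x)) x := by
  have hP := Vseq_props Q Φ Ψ hΦ hΨ
  have hlim : ∀ x, Tendsto (fun k => Vseq Q Φ Ψ k x) atTop (nhds (⨆ k, Vseq Q Φ Ψ k x)) :=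
    fun x => tendsto_atTop_ciSup (monotone_nat_of_le_succ fun k => Vseq_step Q Φ Ψ hΦ hΨ k x)
      ⟨1, by rintro _ ⟨k, rfl⟩; exact (hP k).2.2 x⟩
  generalize hV : (fun x => ⨆ k, Vseq Q Φ Ψ k x) = V
  have hlim : ∀ x, Tendsto (fun k => Vseq Q Φ Ψ k x) atTop (nhds (V x)) := by
    subst hV; exact hlim
  have h0 : ∀ x, 0 ≤ V x := fun x => ge_of_tendsto' (hlim x) fun k => (hP k).2.1 x
  have h1 : ∀ x, V x ≤ 1 := fun x => le_of_tendsto' (hlim x) fun k => (hP k).2.2 x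
  have hfix : ∀ x, V x = Lop Q Φ Ψ V x := by
    intro x
    have hint : Tendsto (fun k => ∫ ξ, Vseq Q Φ Ψ k ξ ∂(Q x)) atTop (nhds (∫ ξ, V ξ ∂(Q x))) := by
      refine tendsto_integral_of_dominated_convergence (fun _ => (1 : ℝ))
        (fun k => (hP k).1.aestronglyMeasurable) (integrable_const _)
        (fun k => Eventually.of_forall fun y => ?_) (Eventually.of_forall hlim)
      rw [Real.norm_eq_abs, abs_of_nonneg ((hP k).2.1 y)]
      exact (hP k).2.2 y
    refine tendsto_nhds_unique ((tendsto_add_atTop_iff_nat 1).2 (hlim x)) ?_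
    change Tendsto (fun k => Lop Q Φ Ψ (Vseq Q Φ Ψ k) x) atTop _
    unfold Lop
    by_cases h : x ∈ Φ \ Ψ
    · simpa only [Set.indicator_of_mem h] using hint.const_add _
    · simp only [Set.indicator_of_notMem h]
      exact tendsto_const_nhds
  refine ⟨V, hlim, ⟨?_, ⟨1, fun x => ?_⟩, h0, h1, fun x hx => ?_, fun x hx => ?_⟩, hfix⟩
  · exact measurable_of_tendsto_metrizable (fun k => (hP k).1) (tendsto_pi_nhds.2 hlim)
  · rw [abs_of_nonneg (h0 x)]
    exact h1 x
  · rw [hfix x]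
    simp [Lop, hx]
  · rw [hfix x]
    have ha : x ∉ Φ := fun h => hx (Or.inl h)
    have hb : x ∉ Ψ := fun h => hx (Or.inr h)
    simp [Lop, ha, hb]
end

section
/- For every bounded measurable nonnegative function W : X → ℝ satisfying the integral equation W(x) = 1_Ψ(x) + 1_{Φ\Ψ}(x) ∫_X W(ξ) Q(x, dξ) for all x ∈ X, one has V(x) ≤ W(x) for all x ∈ X. Consequently, V is the pointwise minimum of the family of all nonnegative solutions of this integral equation. -/
open MeasureTheory ProbabilityTheory Filter

theorem Lop_meas_aux {X : Type*} [MeasurableSpace X] (Q : Kernel X X) [IsMarkovKernel Q]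
    {Φ Ψ : Set X} (hΦ : MeasurableSet Φ) (hΨ : MeasurableSet Ψ) {W : X → ℝ}
    (hW : Measurable W) : Measurable (Lop Q Φ Ψ W) := by
  have h : Measurable (fun x => ∫ ξ, W ξ ∂(Q x)) :=
    (hW.stronglyMeasurable.integral_kernel (κ := Q)).measurable
  have h2 : Lop Q Φ Ψ W = fun x => Ψ.indicator (fun _ => (1 : ℝ)) x +
      (Φ \ Ψ).indicator (fun y => ∫ ξ, W ξ ∂(Q y)) x := by
    funext x
    simp only [Lop, Set.indicator]
  rw [h2]
  exact (measurable_const.indicator hΨ).add (h.indicator (hΦ.diff hΨ))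

theorem Vseq_aux {X : Type*} [MeasurableSpace X] (Q : Kernel X X) [IsMarkovKernel Q]
    {Φ Ψ : Set X} (hΦ : MeasurableSet Φ) (hΨ : MeasurableSet Ψ) (k : ℕ) :
    Measurable (Vseq Q Φ Ψ k) ∧ (∀ x, 0 ≤ Vseq Q Φ Ψ k x) ∧ ∀ x, Vseq Q Φ Ψ k x ≤ 1 := by
  classical
  induction k with
  | zero =>
    refine ⟨measurable_const.indicator hΨ, fun x => ?_, fun x => ?_⟩ <;>
    · simp only [Vseq, Set.indicator]
      split_ifs <;> norm_num
  | succ k ih =>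
    obtain ⟨hm, h0, h1⟩ := ih
    refine ⟨Lop_meas_aux Q hΦ hΨ hm, fun x => ?_, fun x => ?_⟩
    · have : 0 ≤ ∫ ξ, Vseq Q Φ Ψ k ξ ∂(Q x) := integral_nonneg h0
      simp only [Vseq, Lop, Set.indicator]
      split_ifs <;> linarith
    · have : ∫ ξ, Vseq Q Φ Ψ k ξ ∂(Q x) ≤ 1 := by
        have hi : Integrable (Vseq Q Φ Ψ k) (Q x) :=
          Integrable.of_bound hm.aestronglyMeasurable 1
            (Eventually.of_forall fun y => by
              rw [Real.norm_eq_abs, abs_of_nonneg (h0 y)]; exact h1 y)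
        have := integral_mono hi (integrable_const (1 : ℝ)) h1
        simpa using this
      simp only [Vseq, Lop, Set.indicator]
      split_ifs with ha hb
      · exact absurd ha hb.2
      all_goals linarith

/-- `V` is dominated by every nonnegative bounded measurable solution `W` of the
integral equation `W = L[W]`; consequently `V` is the pointwise minimum of the family
of all such nonnegative solutions. -/
theorem V_min_solution {X : Type*} [MeasurableSpace X] [StandardBorelSpace X] [Nonempty X]
    (Q : Kernel X X) [IsMarkovKernel Q]
    (Φ Ψ : Set X) (hΦ : MeasurableSet Φ) (hΨ : MeasurableSet Ψ)
    (V : X → ℝ) (hV : ∀ x, Tendsto (fun k => Vseq Q Φ Ψ k x) atTop (nhds (V x))) :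
    (∀ W : X → ℝ, Measurable W → (∃ C, ∀ x, |W x| ≤ C) → (∀ x, 0 ≤ W x) →
      (∀ x, W x = Lop Q Φ Ψ W x) → ∀ x, V x ≤ W x) ∧
    ∀ x, IsLeast
      ((fun W : X → ℝ => W x) ''
        {W | Measurable W ∧ (∃ C, ∀ y, |W y| ≤ C) ∧ (∀ y, 0 ≤ W y) ∧
          ∀ y, W y = Lop Q Φ Ψ W y})
      (V x) := by
  classical
  have key : ∀ W : X → ℝ, Measurable W → (∃ C, ∀ x, |W x| ≤ C) → (∀ x, 0 ≤ W x) →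
      (∀ x, W x = Lop Q Φ Ψ W x) → ∀ x, V x ≤ W x := by
    rintro W hWm ⟨C, hC⟩ hW0 hWe x
    have hWi : ∀ y, Integrable W (Q y) := fun y =>
      Integrable.of_bound hWm.aestronglyMeasurable C
        (Eventually.of_forall fun z => by rw [Real.norm_eq_abs]; exact hC z)
    have hk : ∀ k y, Vseq Q Φ Ψ k y ≤ W y := by
      intro k
      induction k with
      | zero =>
        intro y
        have : 0 ≤ ∫ ξ, W ξ ∂(Q y) := integral_nonneg hW0
        rw [hWe y]
        simp only [Vseq, Lop, Set.indicator]
        split_ifs <;> linarith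
      | succ k ih =>
        intro y
        have : ∫ ξ, Vseq Q Φ Ψ k ξ ∂(Q y) ≤ ∫ ξ, W ξ ∂(Q y) :=
          integral_mono_of_nonneg (Eventually.of_forall (Vseq_aux Q hΦ hΨ k).2.1) (hWi y)
            (Eventually.of_forall ih)
        rw [hWe y]
        simp only [Vseq, Lop, Set.indicator]
        split_ifs <;> linarith
    exact le_of_tendsto (hV x) (Eventually.of_forall fun k => hk k x)
  refine ⟨key, fun x => ⟨⟨V, ⟨?_, ?_, ?_, ?_⟩, rfl⟩, ?_⟩⟩
  · exact measurable_of_tendsto_metrizable (fun k => (Vseq_aux Q hΦ hΨ k).1)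
      (tendsto_pi_nhds.2 hV)
  · refine ⟨1, fun y => abs_le.2 ⟨?_, ?_⟩⟩
    · have := ge_of_tendsto (hV y) (Eventually.of_forall fun k => (Vseq_aux Q hΦ hΨ k).2.1 y)
      linarith
    · exact le_of_tendsto (hV y) (Eventually.of_forall fun k => (Vseq_aux Q hΦ hΨ k).2.2 y)
  · exact fun y => ge_of_tendsto (hV y)
      (Eventually.of_forall fun k => (Vseq_aux Q hΦ hΨ k).2.1 y)
  · intro y
    have hint : Tendsto (fun k => ∫ ξ, Vseq Q Φ Ψ k ξ ∂(Q y)) atTop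
        (nhds (∫ ξ, V ξ ∂(Q y))) := by
      refine tendsto_integral_of_dominated_convergence (fun _ => (1 : ℝ))
        (fun k => (Vseq_aux Q hΦ hΨ k).1.aestronglyMeasurable) (integrable_const _)
        (fun k => Eventually.of_forall fun z => ?_) (Eventually.of_forall hV)
      rw [Real.norm_eq_abs, abs_of_nonneg ((Vseq_aux Q hΦ hΨ k).2.1 z)]
      exact (Vseq_aux Q hΦ hΨ k).2.2 z
    have h1 : Tendsto (fun k => Vseq Q Φ Ψ (k + 1) y) atTop (nhds (V y)) :=
      (hV y).comp (tendsto_add_atTop_nat 1)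
    refine tendsto_nhds_unique h1 ?_
    simp only [Vseq, Lop]
    refine tendsto_const_nhds.add ?_
    by_cases hy : y ∈ Φ \ Ψ
    · simpa only [Set.indicator_of_mem hy] using hint
    · simp only [Set.indicator_of_notMem hy]
      exact tendsto_const_nhds
  · rintro _ ⟨W, ⟨hm, hb, h0, he⟩, rfl⟩
    exact key W hm hb h0 he x
end

section
/- Suppose α := sup_{x ∈ Φ\Ψ} Q(x, Φ\Ψ) < 1. Then L is a contraction on M_b^{01}(Φ,Ψ) with respect to the supremum norm: for all W₁, W₂ ∈ M_b^{01}(Φ,Ψ), ‖L[W₁] − L[W₂]‖_∞ ≤ α ‖W₁ − W₂‖_∞. -/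
open MeasureTheory ProbabilityTheory Filter

/-- If `α := sup_{x ∈ Φ\Ψ} Q(x, Φ\Ψ) < 1`, then `L` is an `α`-contraction on
`M_b^{01}(Φ,Ψ)` for the supremum norm. -/
theorem Lop_contraction {X : Type*} [MeasurableSpace X] [StandardBorelSpace X] [Nonempty X]
    (Q : Kernel X X) [IsMarkovKernel Q]
    (Φ Ψ : Set X) (hΦ : MeasurableSet Φ) (hΨ : MeasurableSet Ψ)
    (hα : (⨆ x ∈ Φ \ Ψ, Q x (Φ \ Ψ)) < 1) :
    ∀ W₁ ∈ Mb01 Φ Ψ, ∀ W₂ ∈ Mb01 Φ Ψ,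
      (⨆ x : X, |Lop Q Φ Ψ W₁ x - Lop Q Φ Ψ W₂ x|) ≤
        (⨆ x ∈ Φ \ Ψ, Q x (Φ \ Ψ)).toReal * ⨆ x : X, |W₁ x - W₂ x| := by
  intro W₁ h₁ W₂ h₂
  obtain ⟨m1, -, p1, q1, o1, z1⟩ := h₁
  obtain ⟨m2, -, p2, q2, o2, z2⟩ := h₂
  set α := ⨆ x ∈ Φ \ Ψ, Q x (Φ \ Ψ) with hαdef
  have bdd : BddAbove (Set.range fun x => |W₁ x - W₂ x|) := by
    refine ⟨1, ?_⟩
    rintro _ ⟨x, rfl⟩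
    have := p1 x; have := q1 x; have := p2 x; have := q2 x
    exact abs_le.2 ⟨by linarith, by linarith⟩
  set S := ⨆ x : X, |W₁ x - W₂ x| with hS
  have hle : ∀ x, |W₁ x - W₂ x| ≤ S := fun x => le_ciSup bdd x
  have S0 : 0 ≤ S := Real.iSup_nonneg fun x => abs_nonneg _
  have hm : MeasurableSet (Φ \ Ψ) := hΦ.diff hΨ
  refine ciSup_le fun x => ?_
  by_cases hx : x ∈ Φ \ Ψ
  · have i1 : Integrable W₁ (Q x) := Integrable.of_bound m1.aestronglyMeasurable 1
      (Eventually.of_forall fun y => by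
        rw [Real.norm_eq_abs, abs_of_nonneg (p1 y)]; exact q1 y)
    have i2 : Integrable W₂ (Q x) := Integrable.of_bound m2.aestronglyMeasurable 1
      (Eventually.of_forall fun y => by
        rw [Real.norm_eq_abs, abs_of_nonneg (p2 y)]; exact q2 y)
    have e : Lop Q Φ Ψ W₁ x - Lop Q Φ Ψ W₂ x = ∫ y, (W₁ y - W₂ y) ∂(Q x) := by
      rw [integral_sub i1 i2]
      simp only [Lop, Set.indicator_of_mem hx]
      ring
    have hb : ∀ y, |W₁ y - W₂ y| ≤ (Φ \ Ψ).indicator (fun _ => S) y := by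
      intro y
      by_cases hy : y ∈ Φ \ Ψ
      · rw [Set.indicator_of_mem hy]; exact hle y
      · rw [Set.indicator_of_notMem hy]
        by_cases hy' : y ∈ Ψ
        · simp [o1 y hy', o2 y hy']
        · have hc : y ∈ (Φ ∪ Ψ)ᶜ := by
            rintro (h | h)
            · exact hy ⟨h, hy'⟩
            · exact hy' h
          simp [z1 y hc, z2 y hc]
    have hQ : (Q x).real (Φ \ Ψ) ≤ α.toReal :=
      ENNReal.toReal_mono (hα.trans ENNReal.one_lt_top).ne
        (le_iSup₂ (f := fun x (_ : x ∈ Φ \ Ψ) => Q x (Φ \ Ψ)) x hx)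
    rw [e]
    calc |∫ y, (W₁ y - W₂ y) ∂(Q x)| ≤ ∫ y, |W₁ y - W₂ y| ∂(Q x) := abs_integral_le_integral_abs
      _ ≤ ∫ y, (Φ \ Ψ).indicator (fun _ => S) y ∂(Q x) :=
        integral_mono (i1.sub i2).abs ((integrable_const S).indicator hm) hb
      _ = (Q x).real (Φ \ Ψ) * S := by
        rw [integral_indicator_const S hm, smul_eq_mul]
      _ ≤ α.toReal * S := mul_le_mul_of_nonneg_right hQ S0
  · have : Lop Q Φ Ψ W₁ x - Lop Q Φ Ψ W₂ x = 0 := by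
      simp only [Lop, Set.indicator_of_notMem hx]
      ring
    rw [this, abs_zero]
    exact mul_nonneg ENNReal.toReal_nonneg S0
end

section
/- Suppose sup_{x ∈ Φ\Ψ} Q(x, Φ\Ψ) < 1. Then the integral equation W(x) = 1_Ψ(x) + 1_{Φ\Ψ}(x) ∫_X W(ξ) Q(x, dξ) has a unique solution V in M_b^{01}(Φ,Ψ), and the iterates V_k (defined by V_0 := 1_Ψ, V_{k+1} := L[V_k]) converge to V in the supremum norm, i.e. uniformly on X. -/
open MeasureTheory ProbabilityTheory Filter

lemma Mb01_integrable {X : Type*} [MeasurableSpace X] {Φ Ψ : Set X} {W : X → ℝ}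
    (hW : W ∈ Mb01 Φ Ψ) (μ : Measure X) [IsProbabilityMeasure μ] : Integrable W μ := by
  obtain ⟨hm, -, h0, h1, -, -⟩ := hW
  refine Integrable.of_bound hm.aestronglyMeasurable 1 (Eventually.of_forall fun x => ?_)
  rw [Real.norm_eq_abs, abs_of_nonneg (h0 x)]
  exact h1 x

lemma Mb01_Lop {X : Type*} [MeasurableSpace X] (Q : Kernel X X) [IsMarkovKernel Q]
    {Φ Ψ : Set X} (hΦ : MeasurableSet Φ) (hΨ : MeasurableSet Ψ) {W : X → ℝ}
    (hW : W ∈ Mb01 Φ Ψ) : Lop Q Φ Ψ W ∈ Mb01 Φ Ψ := by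
  have hint : ∀ x, Integrable W (Q x) := fun x => Mb01_integrable hW (Q x)
  obtain ⟨hm, -, h0, h1, -, -⟩ := hW
  have i0 : ∀ x, 0 ≤ ∫ ξ, W ξ ∂(Q x) := fun x => integral_nonneg h0
  have i1 : ∀ x, ∫ ξ, W ξ ∂(Q x) ≤ 1 := fun x => by
    have := integral_mono (hint x) (integrable_const (1 : ℝ)) h1
    simpa using this
  have b0 : ∀ x, 0 ≤ Lop Q Φ Ψ W x := fun x => by
    have := i0 x
    by_cases h : x ∈ Ψ <;> by_cases h' : x ∈ Φ <;> simp [Lop, Set.indicator, h, h', this]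
  have b1 : ∀ x, Lop Q Φ Ψ W x ≤ 1 := fun x => by
    have := i1 x
    by_cases h : x ∈ Ψ <;> by_cases h' : x ∈ Φ <;> simp [Lop, Set.indicator, h, h', this]
  refine ⟨?_, ⟨1, fun x => by rw [abs_of_nonneg (b0 x)]; exact b1 x⟩, b0, b1, ?_, ?_⟩
  · have hmi : Measurable fun x => ∫ ξ, W ξ ∂(Q x) :=
      (hm.stronglyMeasurable.integral_kernel (κ := Q)).measurable
    have : Lop Q Φ Ψ W = fun x => Ψ.indicator (fun _ => (1 : ℝ)) x +
        (Φ \ Ψ).indicator (fun y => ∫ ξ, W ξ ∂(Q y)) x := by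
      funext x
      simp [Lop, Set.indicator]
    rw [this]
    exact (measurable_const.indicator hΨ).add (hmi.indicator (hΦ.diff hΨ))
  · intro x hx
    simp [Lop, hx]
  · intro x hx
    simp only [Set.mem_compl_iff, Set.mem_union, not_or] at hx
    simp [Lop, hx.1, hx.2]

lemma Lop_contract {X : Type*} [MeasurableSpace X] (Q : Kernel X X) [IsMarkovKernel Q]
    {Φ Ψ : Set X} (hΦ : MeasurableSet Φ) (hΨ : MeasurableSet Ψ) {a c : ℝ} (ha : 0 ≤ a)
    (hc : 0 ≤ c) (hQ : ∀ x ∈ Φ \ Ψ, (Q x).real (Φ \ Ψ) ≤ a) {U W : X → ℝ}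
    (hU : U ∈ Mb01 Φ Ψ) (hW : W ∈ Mb01 Φ Ψ) (h : ∀ x, |U x - W x| ≤ c) (x : X) :
    |Lop Q Φ Ψ U x - Lop Q Φ Ψ W x| ≤ a * c := by
  by_cases hx : x ∈ Φ \ Ψ
  · have hU' := Mb01_integrable hU (Q x)
    have hW' := Mb01_integrable hW (Q x)
    have e : Lop Q Φ Ψ U x - Lop Q Φ Ψ W x = ∫ ξ, (U ξ - W ξ) ∂(Q x) := by
      rw [integral_sub hU' hW']
      simp only [Lop, Set.indicator_of_mem hx]
      ring
    rw [e]
    calc |∫ ξ, (U ξ - W ξ) ∂(Q x)| ≤ ∫ ξ, |U ξ - W ξ| ∂(Q x) := abs_integral_le_integral_abs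
      _ ≤ ∫ ξ, (Φ \ Ψ).indicator (fun _ => c) ξ ∂(Q x) := by
        refine integral_mono (hU'.sub hW').abs
          ((integrable_const c).indicator (hΦ.diff hΨ)) fun ξ => ?_
        by_cases hξ : ξ ∈ Φ \ Ψ
        · simp only [Set.indicator_of_mem hξ]
          exact h ξ
        · simp only [Set.indicator_of_notMem hξ]
          by_cases hp : ξ ∈ Ψ
          · simp [hU.2.2.2.2.1 ξ hp, hW.2.2.2.2.1 ξ hp]
          · have : ξ ∈ (Φ ∪ Ψ)ᶜ := by
              simp only [Set.mem_diff, not_and, not_not] at hξ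
              simp only [Set.mem_compl_iff, Set.mem_union, not_or]
              exact ⟨fun q => hp (hξ q), hp⟩
            simp [hU.2.2.2.2.2 ξ this, hW.2.2.2.2.2 ξ this]
      _ = (Q x).real (Φ \ Ψ) * c := by
        rw [integral_indicator_const _ (hΦ.diff hΨ), smul_eq_mul]
      _ ≤ a * c := mul_le_mul_of_nonneg_right (hQ x hx) hc
  · simp only [Lop, Set.indicator_of_notMem hx]
    simp only [sub_self, abs_zero]
    positivity

/-- If `sup_{x ∈ Φ\Ψ} Q(x, Φ\Ψ) < 1`, the integral equation `W = L[W]` has a unique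
solution `V` in `M_b^{01}(Φ,Ψ)`, and the iterates `V_k` converge to `V` uniformly. -/
theorem V_unique_uniform {X : Type*} [MeasurableSpace X] [StandardBorelSpace X] [Nonempty X]
    (Q : Kernel X X) [IsMarkovKernel Q]
    (Φ Ψ : Set X) (hΦ : MeasurableSet Φ) (hΨ : MeasurableSet Ψ)
    (hα : (⨆ x ∈ Φ \ Ψ, Q x (Φ \ Ψ)) < 1) :
    ∃ V : X → ℝ, V ∈ Mb01 Φ Ψ ∧ (∀ x, V x = Lop Q Φ Ψ V x) ∧
      (∀ W ∈ Mb01 Φ Ψ, (∀ x, W x = Lop Q Φ Ψ W x) → W = V) ∧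
      TendstoUniformly (fun k => Vseq Q Φ Ψ k) V atTop := by
  obtain ⟨a, ha0, ha1, hQ⟩ : ∃ a : ℝ, 0 ≤ a ∧ a < 1 ∧
      ∀ x ∈ Φ \ Ψ, (Q x).real (Φ \ Ψ) ≤ a := by
    refine ⟨(⨆ x ∈ Φ \ Ψ, Q x (Φ \ Ψ)).toReal, ENNReal.toReal_nonneg, ?_, fun x hx => ?_⟩
    · have := (ENNReal.toReal_lt_toReal hα.ne_top ENNReal.one_ne_top).2 hα
      simpa using this
    · exact ENNReal.toReal_mono hα.ne_top (le_iSup₂ (f := fun x (_ : x ∈ Φ \ Ψ) => Q x (Φ \ Ψ)) x hx)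
  have hmem : ∀ k, Vseq Q Φ Ψ k ∈ Mb01 Φ Ψ := by
    intro k
    induction k with
    | zero =>
      refine ⟨measurable_const.indicator hΨ, ⟨1, fun x => ?_⟩, fun x => ?_, fun x => ?_,
        fun x hx => ?_, fun x hx => ?_⟩
      · by_cases h : x ∈ Ψ <;> simp [Vseq, h]
      · by_cases h : x ∈ Ψ <;> simp [Vseq, h]
      · by_cases h : x ∈ Ψ <;> simp [Vseq, h]
      · simp [Vseq, hx]
      · simp only [Set.mem_compl_iff, Set.mem_union, not_or] at hx
        simp [Vseq, hx.2]
    | succ k ih => exact Mb01_Lop Q hΦ hΨ ih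
  have hone : ∀ U ∈ Mb01 Φ Ψ, ∀ W ∈ Mb01 Φ Ψ, ∀ x, |U x - W x| ≤ 1 := by
    intro U hU W hW x
    have h1 := hU.2.2.1 x
    have h2 := hU.2.2.2.1 x
    have h3 := hW.2.2.1 x
    have h4 := hW.2.2.2.1 x
    rw [abs_le]
    constructor <;> linarith
  have hstep : ∀ k x, |Vseq Q Φ Ψ k x - Vseq Q Φ Ψ (k + 1) x| ≤ a ^ k := by
    intro k
    induction k with
    | zero =>
      intro x
      simpa using hone _ (hmem 0) _ (hmem 1) x
    | succ k ih =>
      intro x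
      rw [pow_succ']
      exact Lop_contract Q hΦ hΨ ha0 (by positivity) hQ (hmem k) (hmem (k + 1)) ih x
  have hd : ∀ x k, dist (Vseq Q Φ Ψ k x) (Vseq Q Φ Ψ (k + 1) x) ≤ 1 * a ^ k := by
    intro x k
    rw [Real.dist_eq, one_mul]
    exact hstep k x
  have hlim : ∀ x, ∃ l, Tendsto (fun k => Vseq Q Φ Ψ k x) atTop (nhds l) := fun x =>
    cauchySeq_tendsto_of_complete (cauchySeq_of_le_geometric a 1 ha1 (hd x))
  choose V hV using hlim
  have hb : ∀ k x, |Vseq Q Φ Ψ k x - V x| ≤ 1 * a ^ k / (1 - a) := by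
    intro k x
    rw [← Real.dist_eq]
    exact dist_le_of_le_geometric_of_tendsto a 1 ha1 (hd x) (hV x) k
  have hb0 : Tendsto (fun k : ℕ => 1 * a ^ k / (1 - a)) atTop (nhds 0) := by
    have := ((tendsto_pow_atTop_nhds_zero_of_lt_one ha0 ha1).const_mul 1).div_const (1 - a)
    simpa using this
  have hVm : V ∈ Mb01 Φ Ψ := by
    have h0 : ∀ x, 0 ≤ V x := fun x =>
      ge_of_tendsto' (hV x) fun k => (hmem k).2.2.1 x
    have h1 : ∀ x, V x ≤ 1 := fun x =>
      le_of_tendsto' (hV x) fun k => (hmem k).2.2.2.1 x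
    refine ⟨measurable_of_tendsto_metrizable (fun k => (hmem k).1) (tendsto_pi_nhds.2 hV),
      ⟨1, fun x => by rw [abs_of_nonneg (h0 x)]; exact h1 x⟩, h0, h1, fun x hx => ?_,
      fun x hx => ?_⟩
    · refine tendsto_nhds_unique (hV x) ?_
      simp only [(hmem _).2.2.2.2.1 x hx]
      exact tendsto_const_nhds
    · refine tendsto_nhds_unique (hV x) ?_
      simp only [(hmem _).2.2.2.2.2 x hx]
      exact tendsto_const_nhds
  have hfix : ∀ x, V x = Lop Q Φ Ψ V x := by
    intro x
    refine tendsto_nhds_unique ((tendsto_add_atTop_iff_nat 1).2 (hV x)) ?_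
    rw [tendsto_iff_dist_tendsto_zero]
    have h2 := hb0.const_mul a
    rw [mul_zero] at h2
    refine squeeze_zero (fun _ => dist_nonneg) (fun k => ?_) h2
    rw [Real.dist_eq]
    have : 0 < 1 - a := by linarith
    exact Lop_contract Q hΦ hΨ ha0 (by positivity) hQ (hmem k) hVm (hb k) x
  refine ⟨V, hVm, hfix, ?_, ?_⟩
  · intro W hW hWf
    have hk : ∀ k : ℕ, ∀ x, |W x - V x| ≤ a ^ k := by
      intro k
      induction k with
      | zero =>
        intro x
        simpa using hone W hW V hVm x
      | succ k ih =>
        intro x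
        rw [pow_succ', hWf x, hfix x]
        exact Lop_contract Q hΦ hΨ ha0 (by positivity) hQ hW hVm ih x
    funext x
    have := ge_of_tendsto' (tendsto_pow_atTop_nhds_zero_of_lt_one ha0 ha1) fun k => hk k x
    exact sub_eq_zero.1 (abs_nonpos_iff.1 this)
  · rw [Metric.tendstoUniformly_iff]
    intro ε hε
    filter_upwards [hb0.eventually_lt_const hε] with k hk x
    rw [dist_comm, Real.dist_eq]
    exact (hb k x).trans_lt hk
end

section
/- Suppose that for every x ∈ X, P_x-almost every trajectory ω ∈ X^ℕ leaves the set Φ\Ψ in finite time (i.e. τ∧τ' < ∞ almost surely, where τ is the first hitting time of Ψ and τ' is the first hitting time of X \ (Φ ∪ Ψ)). Then for every u ∈ M_b^{01}(Φ,Ψ) satisfying u(x) ≥ L[u](x) for all x ∈ X, one has u(x) ≥ V(x) for all x ∈ X. Consequently, V is the unique solution of the equation u = L[u] on the set M_b^{01}(Φ,Ψ). -/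
open MeasureTheory ProbabilityTheory Filter

/-- The first hitting time of the set `S` by the trajectory `ω`, with value `⊤` (i.e.
`∞`) if `S` is never visited. -/
noncomputable def hitTime {X : Type*} (S : Set X) (ω : ℕ → X) : ℕ∞ :=
  sInf (Set.image (fun n : ℕ => (n : ℕ∞)) {n : ℕ | ω n ∈ S})
theorem aux_int {X : Type*} [MeasurableSpace X] (Q : Kernel X X) [IsMarkovKernel Q]
    {Φ Ψ : Set X} {W : X → ℝ} (h : W ∈ Mb01 Φ Ψ) (x : X) : Integrable W (Q x) := by
  obtain ⟨hm, ⟨C, hC⟩, -⟩ := h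
  exact Integrable.of_bound hm.aestronglyMeasurable C (ae_of_all _ hC)

theorem aux_mem {X : Type*} [MeasurableSpace X] (Q : Kernel X X) [IsMarkovKernel Q]
    {Φ Ψ : Set X} (hΦ : MeasurableSet Φ) (hΨ : MeasurableSet Ψ)
    {W : X → ℝ} (h : W ∈ Mb01 Φ Ψ) : Lop Q Φ Ψ W ∈ Mb01 Φ Ψ := by
  have hi := aux_int Q h
  obtain ⟨hm, -, h0, h1, -, -⟩ := h
  have hI0 : ∀ x, 0 ≤ ∫ ξ, W ξ ∂(Q x) := fun x => integral_nonneg h0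
  have hI1 : ∀ x, ∫ ξ, W ξ ∂(Q x) ≤ 1 := fun x => by
    have := integral_mono (hi x) (integrable_const (1 : ℝ)) h1
    simpa using this
  have hL0 : ∀ x, 0 ≤ Lop Q Φ Ψ W x := by
    intro x
    by_cases hx : x ∈ Ψ <;> by_cases hy : x ∈ Φ <;> simp [Lop, hx, hy, hI0]
  have hL1 : ∀ x, Lop Q Φ Ψ W x ≤ 1 := by
    intro x
    by_cases hx : x ∈ Ψ <;> by_cases hy : x ∈ Φ <;> simp [Lop, hx, hy, hI1]
  refine ⟨?_, ⟨1, fun x => abs_le.2 ⟨by linarith [hL0 x], hL1 x⟩⟩, hL0, hL1, ?_, ?_⟩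
  · have hmI : Measurable (fun x => ∫ ξ, W ξ ∂(Q x)) :=
      (hm.stronglyMeasurable.integral_kernel (κ := Q)).measurable
    exact (measurable_const.indicator hΨ).add (hmI.indicator (hΦ.diff hΨ))
  · intro x hx
    simp [Lop, hx]
  · intro x hx
    have h1 : x ∉ Ψ := fun h => hx (Or.inr h)
    have h2 : x ∉ Φ := fun h => hx (Or.inl h)
    simp [Lop, h1, h2]

theorem aux_Vseq {X : Type*} [MeasurableSpace X] (Q : Kernel X X) [IsMarkovKernel Q]
    {Φ Ψ : Set X} (hΦ : MeasurableSet Φ) (hΨ : MeasurableSet Ψ) (k : ℕ) :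
    Vseq Q Φ Ψ k ∈ Mb01 Φ Ψ := by
  induction k with
  | zero =>
    rw [Vseq]
    have a : ∀ x, 0 ≤ Ψ.indicator (fun _ => (1 : ℝ)) x := fun x =>
      Set.indicator_nonneg (fun _ _ => zero_le_one) x
    have b : ∀ x, Ψ.indicator (fun _ => (1 : ℝ)) x ≤ 1 := fun x =>
      Set.indicator_le_self' (fun _ _ => zero_le_one) x
    refine ⟨measurable_const.indicator hΨ,
      ⟨1, fun x => abs_le.2 ⟨by linarith [a x], b x⟩⟩, a, b, ?_, ?_⟩
    · intro x hx
      simp [hx]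
    · intro x hx
      have h1 : x ∉ Ψ := fun h => hx (Or.inr h)
      simp [h1]
  | succ k ih => exact aux_mem Q hΦ hΨ ih

theorem aux_le {X : Type*} [MeasurableSpace X] (Q : Kernel X X) [IsMarkovKernel Q]
    {Φ Ψ : Set X} (hΦ : MeasurableSet Φ) (hΨ : MeasurableSet Ψ) {u : X → ℝ}
    (hu : u ∈ Mb01 Φ Ψ) (hL : ∀ x, Lop Q Φ Ψ u x ≤ u x) (k : ℕ) :
    ∀ x, Vseq Q Φ Ψ k x ≤ u x := by
  induction k with
  | zero =>
    intro x
    by_cases hx : x ∈ Ψ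
    · simp [Vseq, hx, hu.2.2.2.2.1 x hx]
    · simp [Vseq, hx, hu.2.2.1 x]
  | succ k ih =>
    intro x
    refine le_trans ?_ (hL x)
    have := integral_mono (aux_int Q (aux_Vseq Q hΦ hΨ k) x) (aux_int Q hu x) ih
    by_cases hx : x ∈ Ψ <;> by_cases hy : x ∈ Φ <;> simp [Vseq, Lop, hx, hy, this]

theorem aux_cyl {X : Type*} [MeasurableSpace X] (Q : Kernel X X) [IsMarkovKernel Q]
    {Φ Ψ : Set X} (hΦ : MeasurableSet Φ) (hΨ : MeasurableSet Ψ) {u : X → ℝ}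
    (hu : u ∈ Mb01 Φ Ψ) (hL : ∀ x, u x = Lop Q Φ Ψ u x) (k : ℕ) :
    ∀ x, ENNReal.ofReal (u x - Vseq Q Φ Ψ k x) ≤ cylProb Q k (fun _ => Φ \ Ψ) x := by
  induction k with
  | zero =>
    intro x
    by_cases hx : x ∈ Ψ
    · simp [Vseq, hx, hu.2.2.2.2.1 x hx]
    · by_cases hy : x ∈ Φ
      · simp [Vseq, cylProb, hx, hy, hu.2.2.2.1 x]
      · have := hu.2.2.2.2.2 x (by simp [hx, hy])
        simp [Vseq, hx, this]
  | succ k ih =>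
    intro x
    have hv := aux_Vseq Q hΦ hΨ k
    have hle := aux_le Q hΦ hΨ hu (fun x => (hL x).ge) k
    have key : ENNReal.ofReal ((∫ ξ, u ξ ∂(Q x)) - ∫ ξ, Vseq Q Φ Ψ k ξ ∂(Q x)) ≤
        ∫⁻ ξ, cylProb Q k (fun _ => Φ \ Ψ) ξ ∂(Q x) := by
      rw [← integral_sub (aux_int Q hu x) (aux_int Q hv x),
        ofReal_integral_eq_lintegral_ofReal (f := fun y => u y - Vseq Q Φ Ψ k y)
          ((aux_int Q hu x).sub (aux_int Q hv x))
          (ae_of_all _ fun y => sub_nonneg.2 (hle y))]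
      exact lintegral_mono ih
    rw [hL x]
    by_cases hx : x ∈ Ψ <;> by_cases hy : x ∈ Φ <;> simp [Vseq, Lop, cylProb, hx, hy]
    simpa using key

/-- If `τ ∧ τ' < ∞` `P_x`-almost surely for every `x`, then every `u ∈ M_b^{01}(Φ,Ψ)`
with `u ≥ L[u]` satisfies `u ≥ V` pointwise; consequently `V` is the unique solution
of `u = L[u]` on `M_b^{01}(Φ,Ψ)`. -/
theorem ge_V_of_ge_Lop_and_unique {X : Type*} [MeasurableSpace X] [StandardBorelSpace X]
    [Nonempty X]
    (Q : Kernel X X) [IsMarkovKernel Q]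
    (Φ Ψ : Set X) (hΦ : MeasurableSet Φ) (hΨ : MeasurableSet Ψ)
    (P : X → Measure (ℕ → X)) [∀ x, IsProbabilityMeasure (P x)]
    (hP : ∀ (x : X) (n : ℕ) (B : ℕ → Set X), (∀ i, MeasurableSet (B i)) →
      P x {ω : ℕ → X | ∀ i ≤ n, ω i ∈ B i} = cylProb Q n B x)
    (hfin : ∀ x : X, ∀ᵐ ω ∂(P x), min (hitTime Ψ ω) (hitTime ((Φ ∪ Ψ)ᶜ) ω) < ⊤)
    (V : X → ℝ) (hV : ∀ x, Tendsto (fun k => Vseq Q Φ Ψ k x) atTop (nhds (V x))) :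
    (∀ u ∈ Mb01 Φ Ψ, (∀ x, Lop Q Φ Ψ u x ≤ u x) → ∀ x, V x ≤ u x) ∧
    (V ∈ Mb01 Φ Ψ ∧ (∀ x, V x = Lop Q Φ Ψ V x) ∧
      ∀ u ∈ Mb01 Φ Ψ, (∀ x, u x = Lop Q Φ Ψ u x) → u = V) := by
  have hlim : ∀ u ∈ Mb01 Φ Ψ, (∀ x, Lop Q Φ Ψ u x ≤ u x) → ∀ x, V x ≤ u x :=
    fun u hu hL x => le_of_tendsto' (hV x) fun k => aux_le Q hΦ hΨ hu hL k x
  have hm := fun k => aux_Vseq Q hΦ hΨ k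
  have h0 : ∀ x, 0 ≤ V x := fun x => ge_of_tendsto' (hV x) fun k => (hm k).2.2.1 x
  have h1 : ∀ x, V x ≤ 1 := fun x => le_of_tendsto' (hV x) fun k => (hm k).2.2.2.1 x
  refine ⟨hlim, ⟨?_, ⟨1, fun x => abs_le.2 ⟨by linarith [h0 x], h1 x⟩⟩, h0, h1, ?_, ?_⟩, ?_, ?_⟩
  · exact measurable_of_tendsto_metrizable (fun k => (hm k).1) (tendsto_pi_nhds.2 hV)
  · intro x hx
    refine tendsto_nhds_unique (hV x) ?_
    simp [fun k => (hm k).2.2.2.2.1 x hx]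
  · intro x hx
    refine tendsto_nhds_unique (hV x) ?_
    simp [fun k => (hm k).2.2.2.2.2 x hx]
  · intro x
    refine tendsto_nhds_unique ((tendsto_add_atTop_iff_nat 1).2 (hV x)) ?_
    have hd : Tendsto (fun k => ∫ ξ, Vseq Q Φ Ψ k ξ ∂(Q x)) atTop (nhds (∫ ξ, V ξ ∂(Q x))) := by
      refine tendsto_integral_of_dominated_convergence (fun _ => 1)
        (fun k => (hm k).1.aestronglyMeasurable) (integrable_const _) ?_ (ae_of_all _ hV)
      intro k
      refine ae_of_all _ fun y => ?_
      rw [Real.norm_eq_abs]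
      exact abs_le.2 ⟨by linarith [(hm k).2.2.1 y], (hm k).2.2.2.1 y⟩
    by_cases hx : x ∈ Ψ <;> by_cases hy : x ∈ Φ <;> simp [Vseq, Lop, hx, hy]
    exact hd
  · intro u hu hL
    funext x
    refine le_antisymm ?_ (hlim u hu (fun x => (hL x).ge) x)
    have hS : MeasurableSet (Φ \ Ψ) := hΦ.diff hΨ
    let A : ℕ → Set (ℕ → X) := fun n => {ω | ∀ i ≤ n, ω i ∈ Φ \ Ψ}
    have hA : ∀ n, MeasurableSet (A n) := by
      intro n
      have : A n = ⋂ i, ⋂ (_ : i ≤ n), (fun ω : ℕ → X => ω i) ⁻¹' (Φ \ Ψ) := by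
        ext ω; simp [A]
      rw [this]
      exact MeasurableSet.iInter fun i => MeasurableSet.iInter fun _ => measurable_pi_apply i hS
    have hanti : Antitone A := fun a b hab ω h i hi => h i (hi.trans hab)
    have hz : P x (⋂ n, A n) = 0 := by
      refine measure_mono_null ?_ (ae_iff.1 (hfin x))
      intro ω hω
      have hω' : ∀ n, ω n ∈ Φ \ Ψ := fun n => (Set.mem_iInter.1 hω n) n le_rfl
      have e1 : {n : ℕ | ω n ∈ Ψ} = ∅ := by
        ext n; simpa using (hω' n).2
      have e2 : {n : ℕ | ω n ∈ (Φ ∪ Ψ)ᶜ} = ∅ := by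
        ext n
        simp only [Set.mem_setOf_eq, Set.mem_empty_iff_false, iff_false]
        exact fun h => h (Or.inl (hω' n).1)
      simp only [Set.mem_setOf_eq, hitTime, e1, e2]
      simp
    have ht : Tendsto (fun n => P x (A n)) atTop (nhds 0) := by
      rw [← hz]
      exact tendsto_measure_iInter_atTop (fun n => (hA n).nullMeasurableSet) hanti
        ⟨0, measure_ne_top _ _⟩
    have h2 : ENNReal.ofReal (u x - V x) ≤ 0 := by
      refine le_of_tendsto_of_tendsto' (ENNReal.tendsto_ofReal ((hV x).const_sub (u x))) ht ?_
      intro n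
      have := hP x n (fun _ => Φ \ Ψ) (fun _ => hS)
      exact (aux_cyl Q hΦ hΨ hu hL n x).trans this.ge
    have := ENNReal.ofReal_eq_zero.1 (le_antisymm h2 bot_le)
    linarith
end

section
/- For every x ∈ X, V(x) equals the probability that the chain started at x hits Ψ before exiting Φ ∪ Ψ: V(x) = P_x(τ < τ' and τ < ∞) = E_x[ Σ_{t=0}^{τ∧τ'} 1_Ψ(X_t) ], where τ is the first hitting time of Ψ and τ' is the first hitting time of X \ (Φ ∪ Ψ). -/
open MeasureTheory ProbabilityTheory Filter

lemma le_hitTime_iff {X : Type*} (S : Set X) (ω : ℕ → X) (t : ℕ) :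
    (t : ℕ∞) ≤ hitTime S ω ↔ ∀ i < t, ω i ∉ S := by
  unfold hitTime
  rw [le_sInf_iff]
  constructor
  · intro h i hi his
    have := h (i : ℕ∞) ⟨i, his, rfl⟩
    have h2 : t ≤ i := by exact_mod_cast this
    omega
  · rintro h _ ⟨i, hi, rfl⟩
    have : t ≤ i := by
      by_contra hc
      exact h i (by omega) hi
    exact Nat.cast_le.2 this

def auxB {X : Type*} (Φ Ψ : Set X) (n i : ℕ) : Set X := if i < n then Φ \ Ψ else
  if i = n then Ψ else Set.univ

def auxA {X : Type*} (Φ Ψ : Set X) (n : ℕ) : Set (ℕ → X) :=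
  {ω | ∀ i ≤ n, ω i ∈ auxB Φ Ψ n i}

lemma mem_auxA {X : Type*} (Φ Ψ : Set X) (n : ℕ) (ω : ℕ → X) :
    ω ∈ auxA Φ Ψ n ↔ ω n ∈ Ψ ∧ ∀ i < n, ω i ∈ Φ \ Ψ := by
  unfold auxA auxB
  constructor
  · intro h
    refine ⟨by simpa using h n le_rfl, fun i hi => by simpa [hi] using h i hi.le⟩
  · rintro ⟨h1, h2⟩ i hi
    rcases hi.lt_or_eq with h | rfl
    · simpa [h] using h2 i h
    · simpa using h1

lemma mem_auxA' {X : Type*} (Φ Ψ : Set X) (n : ℕ) (ω : ℕ → X) :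
    ω ∈ auxA Φ Ψ n ↔ ω n ∈ Ψ ∧ (n : ℕ∞) ≤ min (hitTime Ψ ω) (hitTime ((Φ ∪ Ψ)ᶜ) ω) := by
  rw [mem_auxA, le_min_iff, le_hitTime_iff, le_hitTime_iff]
  simp only [Set.mem_sdiff, Set.mem_compl_iff, Set.mem_union]
  grind

lemma event_eq {X : Type*} (Φ Ψ : Set X) :
    {ω : ℕ → X | hitTime Ψ ω < hitTime ((Φ ∪ Ψ)ᶜ) ω ∧ hitTime Ψ ω < ⊤} =
      ⋃ n, auxA Φ Ψ n := by
  ext ω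
  simp only [Set.mem_ofPred_eq, Set.mem_iUnion]
  constructor
  · rintro ⟨h1, h2⟩
    obtain ⟨n, hn⟩ := ENat.ne_top_iff_exists.1 h2.ne
    refine ⟨n, (mem_auxA' _ _ _ _).2 ⟨?_, ?_⟩⟩
    · by_contra hc
      have h3 := (le_hitTime_iff Ψ ω n).1 hn.le
      have : ((n + 1 : ℕ) : ℕ∞) ≤ hitTime Ψ ω := by
        rw [le_hitTime_iff]
        intro i hi
        rcases (Nat.lt_succ_iff.1 hi).lt_or_eq with h | rfl
        · exact h3 i h
        · exact hc
      rw [← hn] at this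
      have : n + 1 ≤ n := by exact_mod_cast this
      omega
    · rw [hn, min_eq_left h1.le]
  · rintro ⟨n, hn⟩
    rw [mem_auxA] at hn
    have h1 : hitTime Ψ ω ≤ (n : ℕ∞) := sInf_le ⟨n, hn.1, rfl⟩
    have h2 : ((n + 1 : ℕ) : ℕ∞) ≤ hitTime ((Φ ∪ Ψ)ᶜ) ω := by
      rw [le_hitTime_iff]
      intro i hi
      rcases (Nat.lt_succ_iff.1 hi).lt_or_eq with h | rfl
      · have := (hn.2 i h).1
        simp [this]
      · simp [hn.1]
    have h3 : (n : ℕ∞) < ((n + 1 : ℕ) : ℕ∞) := by exact_mod_cast Nat.lt_succ_self n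
    exact ⟨(h1.trans_lt h3).trans_le h2, h1.trans_lt (ENat.natCast_lt_top n)⟩

lemma auxB_meas {X : Type*} [MeasurableSpace X] {Φ Ψ : Set X} (hΦ : MeasurableSet Φ)
    (hΨ : MeasurableSet Ψ) (n i : ℕ) : MeasurableSet (auxB Φ Ψ n i) := by
  unfold auxB
  split_ifs
  · exact hΦ.diff hΨ
  · exact hΨ
  · exact MeasurableSet.univ

lemma auxA_meas {X : Type*} [MeasurableSpace X] {Φ Ψ : Set X} (hΦ : MeasurableSet Φ)
    (hΨ : MeasurableSet Ψ) (n : ℕ) : MeasurableSet (auxA Φ Ψ n) := by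
  have : auxA Φ Ψ n = ⋂ i, ⋂ (_ : i ≤ n), (fun ω : ℕ → X => ω i) ⁻¹' auxB Φ Ψ n i := by
    ext ω; simp [auxA]
  rw [this]
  exact MeasurableSet.iInter fun i => MeasurableSet.iInter fun _ =>
    measurable_pi_apply i (auxB_meas hΦ hΨ n i)

lemma auxA_disj {X : Type*} (Φ Ψ : Set X) :
    Pairwise (Function.onFun Disjoint (auxA Φ Ψ)) := by
  intro m n hmn
  refine Set.disjoint_left.2 fun ω hm hn => ?_
  rw [mem_auxA] at hm hn
  rcases lt_or_gt_of_ne hmn with h | h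
  · exact (hn.2 m h).2 hm.1
  · exact (hm.2 n h).2 hn.1

lemma cyl_zero {X : Type*} [MeasurableSpace X] (Q : Kernel X X) (Φ Ψ : Set X) (x : X) :
    cylProb Q 0 (auxB Φ Ψ 0) x = Ψ.indicator (fun _ => 1) x := by
  simp [cylProb, auxB]

lemma cyl_succ {X : Type*} [MeasurableSpace X] (Q : Kernel X X) (Φ Ψ : Set X) (n : ℕ) (x : X) :
    cylProb Q (n + 1) (auxB Φ Ψ (n + 1)) x =
      (Φ \ Ψ).indicator (fun x => ∫⁻ ξ, cylProb Q n (auxB Φ Ψ n) ξ ∂(Q x)) x := by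
  have h : (fun i => auxB Φ Ψ (n + 1) (i + 1)) = auxB Φ Ψ n := by
    funext i; simp [auxB]
  have h0 : auxB Φ Ψ (n + 1) 0 = Φ \ Ψ := by simp [auxB]
  simp only [cylProb, h, h0]
  rfl

lemma cyl_meas {X : Type*} [MeasurableSpace X] (Q : Kernel X X) {Φ Ψ : Set X}
    (hΦ : MeasurableSet Φ) (hΨ : MeasurableSet Ψ) (n : ℕ) :
    Measurable (cylProb Q n (auxB Φ Ψ n)) := by
  induction n with
  | zero =>
    rw [funext (cyl_zero Q Φ Ψ)]
    exact measurable_const.indicator hΨ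
  | succ n ih =>
    rw [funext (cyl_succ Q Φ Ψ n)]
    exact (ih.lintegral_kernel).indicator (hΦ.diff hΨ)

lemma Vseq_eq {X : Type*} [MeasurableSpace X] (Q : Kernel X X) {Φ Ψ : Set X}
    (hΦ : MeasurableSet Φ) (hΨ : MeasurableSet Ψ)
    (hfin : ∀ n x, cylProb Q n (auxB Φ Ψ n) x < ⊤) (k : ℕ) (x : X) :
    Vseq Q Φ Ψ k x = (∑ n ∈ Finset.range (k + 1), cylProb Q n (auxB Φ Ψ n) x).toReal := by
  induction k generalizing x with
  | zero =>
    simp only [Vseq, zero_add, Finset.sum_range_one, cyl_zero]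
    by_cases h : x ∈ Ψ <;> simp [h]
  | succ k ih =>
    rw [Finset.sum_range_succ', cyl_zero]
    simp only [Vseq, Lop, cyl_succ]
    rw [funext ih, integral_toReal]
    · rw [lintegral_finsetSum _ (fun n _ => cyl_meas Q hΦ hΨ n)]
      by_cases h : x ∈ Ψ
      · simp [h]
      · by_cases h' : x ∈ Φ <;> simp [h, h']
    · exact (Finset.measurable_sum _ (fun n _ => cyl_meas Q hΦ hΨ n)).aemeasurable
    · exact Filter.Eventually.of_forall fun y => ENNReal.sum_lt_top.2 fun n _ => hfin n y

/-- `V(x)` equals the probability that the chain started at `x` hits `Ψ` before exiting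
`Φ ∪ Ψ`, i.e. `V(x) = P_x(τ < τ', τ < ∞) = E_x[Σ_{t=0}^{τ∧τ'} 1_Ψ(X_t)]`. -/
theorem V_eq_prob_hit {X : Type*} [MeasurableSpace X] [StandardBorelSpace X] [Nonempty X]
    (Q : Kernel X X) [IsMarkovKernel Q]
    (Φ Ψ : Set X) (hΦ : MeasurableSet Φ) (hΨ : MeasurableSet Ψ)
    (P : X → Measure (ℕ → X)) [∀ x, IsProbabilityMeasure (P x)]
    (hP : ∀ (x : X) (n : ℕ) (B : ℕ → Set X), (∀ i, MeasurableSet (B i)) →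
      P x {ω : ℕ → X | ∀ i ≤ n, ω i ∈ B i} = cylProb Q n B x)
    (V : X → ℝ) (hV : ∀ x, Tendsto (fun k => Vseq Q Φ Ψ k x) atTop (nhds (V x))) :
    ∀ x : X,
      V x = (P x {ω : ℕ → X |
          hitTime Ψ ω < hitTime ((Φ ∪ Ψ)ᶜ) ω ∧ hitTime Ψ ω < ⊤}).toReal ∧
      V x = (∫⁻ ω : ℕ → X,
          (∑' t : ℕ, if (t : ℕ∞) ≤ min (hitTime Ψ ω) (hitTime ((Φ ∪ Ψ)ᶜ) ω)
            then Ψ.indicator (fun _ => (1 : ENNReal)) (ω t) else 0) ∂(P x)).toReal := by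
  intro x
  have hA : ∀ n y, P y (auxA Φ Ψ n) = cylProb Q n (auxB Φ Ψ n) y := fun n y =>
    hP y n (auxB Φ Ψ n) (auxB_meas hΦ hΨ n)
  have hfin : ∀ n y, cylProb Q n (auxB Φ Ψ n) y < ⊤ := fun n y => by
    rw [← hA]; exact measure_lt_top _ _
  have hU : P x (⋃ n, auxA Φ Ψ n) = ∑' n, cylProb Q n (auxB Φ Ψ n) x := by
    rw [measure_iUnion (auxA_disj Φ Ψ) (auxA_meas hΦ hΨ)]
    simp only [hA]
  have hT : V x = (∑' n, cylProb Q n (auxB Φ Ψ n) x).toReal := by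
    refine tendsto_nhds_unique (hV x) ?_
    simp only [Vseq_eq Q hΦ hΨ hfin]
    refine (ENNReal.tendsto_toReal ?_).comp
      ((ENNReal.tendsto_nat_tsum _).comp (tendsto_add_atTop_nat 1))
    rw [← hU]; exact measure_ne_top _ _
  refine ⟨by rw [event_eq, hU, hT], ?_⟩
  have hI : ∀ (ω : ℕ → X) (t : ℕ),
      (if (t : ℕ∞) ≤ min (hitTime Ψ ω) (hitTime ((Φ ∪ Ψ)ᶜ) ω)
        then Ψ.indicator (fun _ => (1 : ENNReal)) (ω t) else 0) =
      (auxA Φ Ψ t).indicator (fun _ => (1 : ENNReal)) ω := by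
    intro ω t
    have := mem_auxA' Φ Ψ t ω
    by_cases h1 : ω t ∈ Ψ <;>
      by_cases h2 : (t : ℕ∞) ≤ min (hitTime Ψ ω) (hitTime ((Φ ∪ Ψ)ᶜ) ω)
    · rw [if_pos h2, Set.indicator_of_mem h1, Set.indicator_of_mem (this.2 ⟨h1, h2⟩)]
    · rw [if_neg h2, Set.indicator_of_notMem (fun h => h2 (this.1 h).2)]
    · rw [if_pos h2, Set.indicator_of_notMem h1, Set.indicator_of_notMem (fun h => h1 (this.1 h).1)]
    · rw [if_neg h2, Set.indicator_of_notMem (fun h => h2 (this.1 h).2)]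
  simp only [hI]
  rw [lintegral_tsum fun t => (measurable_const.indicator (auxA_meas hΦ hΨ t)).aemeasurable, hT]
  congr 2
  funext t
  rw [lintegral_indicator_const (auxA_meas hΦ hΨ t), one_mul, hA]
end
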